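/- Let 0 < 1/m ≪ α < 1/10⁵ with m ∈ ℕ. Suppose H is a 3-graph on a vertex set V = A ∪ B where A and B are disjoint with |A| = |B| = 6m, and suppose every vertex of H is α-good in H with respect to 𝓑[A,B] (with n = 12m). Then H contains a K₄⁻-factor. -/

import Mathlib

open Finset

/-- `H` is the edge set of a 3-uniform hypergraph (3-graph) on `Fin n`. -/
def Is3Graph (n : ℕ) (H : Finset (Finset (Fin n))) : Prop :=
  ∀ e ∈ H, e.card = 3

/-- `degOn H x y U` : number of `z ∈ U` with `{x,y,z} ∈ H`, i.e. `deg_H(xy, U)`. -/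
def degOn {n : ℕ} (H : Finset (Finset (Fin n))) (x y : Fin n) (U : Finset (Fin n)) : ℕ :=
  (U.filter fun z => ({x, y, z} : Finset (Fin n)) ∈ H).card

/-- The minimum codegree `δ₂(H)` is at least `t`. -/
def CodegLB {n : ℕ} (H : Finset (Finset (Fin n))) (t : ℝ) : Prop :=
  ∀ x y : Fin n, x ≠ y → t ≤ (degOn H x y Finset.univ : ℝ)

/-- `S` spans a copy of `K₄⁻` in `H`: it has 4 vertices and at least 3 of its
four 3-subsets are edges. -/
def SpansK4m {n : ℕ} (H : Finset (Finset (Fin n))) (S : Finset (Fin n)) : Prop :=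
  S.card = 4 ∧ 3 ≤ ((S.powersetCard 3).filter (· ∈ H)).card

/-- `S` spans a copy of `K₄³` (the complete 3-graph on 4 vertices) in `H`. -/
def SpansK43 {n : ℕ} (H : Finset (Finset (Fin n))) (S : Finset (Fin n)) : Prop :=
  S.card = 4 ∧ ((S.powersetCard 3).filter (· ∈ H)).card = 4

/-- The induced subgraph `H[X]` contains a `K₄⁻`-factor. -/
def HasK4mFactorOn {n : ℕ} (H : Finset (Finset (Fin n))) (X : Finset (Fin n)) : Prop :=
  ∃ P : Finset (Finset (Fin n)),
    (∀ S ∈ P, SpansK4m H S) ∧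
    (∀ S ∈ P, ∀ T ∈ P, S ≠ T → Disjoint S T) ∧
    P.biUnion id = X

/-- `S` is an `(x,y)`-connector of length `c` in `H`. -/
def IsConnector {n : ℕ} (H : Finset (Finset (Fin n))) (c : ℕ) (x y : Fin n)
    (S : Finset (Fin n)) : Prop :=
  x ∉ S ∧ y ∉ S ∧ S.card = 4 * c - 1 ∧
    HasK4mFactorOn H (insert x S) ∧ HasK4mFactorOn H (insert y S)

/-- `x` and `y` are `(c,η)`-close in `H` (a 3-graph on `n` vertices). -/
def Close {n : ℕ} (H : Finset (Finset (Fin n))) (c : ℕ) (η : ℝ) (x y : Fin n) : Prop :=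
  η * (n : ℝ) ^ (4 * c - 1) ≤ ({S : Finset (Fin n) | IsConnector H c x y S}.ncard : ℝ)

/-- `U` is `(c,η)`-closed in `H`. -/
def ClosedOn {n : ℕ} (H : Finset (Finset (Fin n))) (c : ℕ) (η : ℝ)
    (U : Finset (Fin n)) : Prop :=
  ∀ x ∈ U, ∀ y ∈ U, x ≠ y → Close H c η x y

/-- The number of `(X,Y)`-bridges `(x,y,S)` of length `c` in `H`. -/
noncomputable def BridgeCount {n : ℕ} (H : Finset (Finset (Fin n))) (c : ℕ)
    (X Y : Finset (Fin n)) : ℕ :=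
  {t : Fin n × Fin n × Finset (Fin n) |
    t.1 ∈ X ∧ t.2.1 ∈ Y ∧ IsConnector H c t.1 t.2.1 t.2.2}.ncard

/-- The 3-graph `𝓑[A,B]`: all triples in `A ∪ B` containing an odd number of
vertices of `A`. -/
def BGraph {n : ℕ} (A B : Finset (Fin n)) : Finset (Finset (Fin n)) :=
  ((A ∪ B).powersetCard 3).filter fun e => (e ∩ A).card % 2 = 1

/-- `H` (a 3-graph on `n` vertices) is `γ`-extremal. -/
def IsExtremal {n : ℕ} (H : Finset (Finset (Fin n))) (γ : ℝ) : Prop :=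
  ∃ A B : Finset (Fin n), Disjoint A B ∧ A ∪ B = Finset.univ ∧
    A.card = n / 2 ∧ B.card = n - n / 2 ∧
    ((BGraph A B \ H).card : ℝ) ≤ γ * (n : ℝ) ^ 3

/-- The number of `V₁V₂V₃`-edges of `H`. -/
def eCount {n : ℕ} (H : Finset (Finset (Fin n))) (A B C : Finset (Fin n)) : ℕ :=
  (H.filter fun e => ∃ a ∈ A, ∃ b ∈ B, ∃ c ∈ C, e = {a, b, c}).card

/-- `Ñ_{c,η}(x)` : the set of vertices `(c,η)`-close to `x` in `H`. -/
def Ntilde {n : ℕ} (H : Finset (Finset (Fin n))) (c : ℕ) (η : ℝ) (x : Fin n) :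
    Set (Fin n) :=
  {y | y ≠ x ∧ Close H c η x y}

/-- The triple `{x,x',y}` is `(ρ,X,Y)`-typical. -/
def TypicalTriple {n : ℕ} (H : Finset (Finset (Fin n))) (ρ : ℝ) (X Y : Finset (Fin n))
    (x x' y : Fin n) : Prop :=
  (Y.card : ℝ) - ρ * n ≤ (degOn H x x' Y : ℝ) ∧
  (((X.filter fun z => ({x, y, z} : Finset (Fin n)) ∈ H ∧
      ({x', y, z} : Finset (Fin n)) ∈ H).card : ℝ) ≤ ρ * n) ∧
  (X.card : ℝ) - ρ * n ≤ (degOn H x y X : ℝ) + (degOn H x' y X : ℝ)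

/-- `Q` spans an `(X,Y)`-bridge of length 1, i.e. `Q = {a,b} ∪ S` for some
`(X,Y)`-bridge `(a,b,S)` of length 1. -/
def SpansBridge1 {n : ℕ} (H : Finset (Finset (Fin n))) (X Y Q : Finset (Fin n)) : Prop :=
  ∃ a ∈ X, ∃ b ∈ Y, ∃ S : Finset (Fin n), IsConnector H 1 a b S ∧
    Q = insert a (insert b S)

/-- Near-complete 4-partite 4-graphs have perfect matchings (switching argument). -/
lemma aux_perm {N : ℕ} (Bad : (Fin 4 → Fin N) → Prop) (C : ℕ)
    (hbad : ∀ (j : Fin 4) (a : Fin N), Nat.card {t : Fin 4 → Fin N // t j = a ∧ Bad t} ≤ C)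
    (hN : 4 * C < (N - 1).descFactorial 3) :
    ∃ σ : Fin 4 → Equiv.Perm (Fin N), ∀ i, ¬ Bad (fun j => σ j i) := by
  classical
  obtain ⟨σ, hσ⟩ := Finite.exists_max
    (fun σ : Fin 4 → Equiv.Perm (Fin N) => (univ.filter fun i => ¬ Bad (fun j => σ j i)).card)
  refine ⟨σ, ?_⟩
  intro i0 hi0
  let T := Fin 3 ↪ {x : Fin N // x ≠ i0}
  let I : T → Fin 4 → Fin N := fun t => Fin.cons i0 (fun k => (t k).1)
  have hI0 : ∀ t, I t 0 = i0 := fun t => rfl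
  have hIs : ∀ t k, I t (Fin.succ k) = (t k).1 := fun t k => rfl
  have hinj : ∀ t, Function.Injective (I t) := by
    intro t
    refine Fin.cons_injective_iff.2 ⟨?_, ?_⟩
    · rintro ⟨k, hk⟩
      exact (t k).2 hk
    · intro a b hab
      exact t.injective (Subtype.ext hab)
  have hcardT : Fintype.card T = (N - 1).descFactorial 3 := by
    simp [T, Fintype.card_embedding_eq, Fintype.card_subtype_compl]
  -- bad choices
  let BT : Fin 4 → Finset T := fun r => univ.filter fun t => Bad (fun j => σ j (I t (r + j)))
  have hBT : ∀ r, (BT r).card ≤ C := by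
    intro r
    refine le_trans ?_ (hbad (-r) (σ (-r) i0))
    rw [Nat.card_eq_fintype_card, Fintype.card_subtype]
    refine card_le_card_of_injOn (fun t j => σ j (I t (r + j))) ?_ ?_
    · intro t ht
      simp only [BT, coe_filter, mem_univ, true_and, Set.mem_setOf_eq] at ht ⊢
      refine ⟨?_, ht⟩
      rw [add_neg_cancel, hI0]
    · intro t _ t' _ h
      apply DFunLike.ext
      intro k
      have h1 := congrFun h (Fin.succ k - r)
      simp only [add_sub_cancel] at h1
      exact Subtype.ext ((σ _).injective h1)
  have hex : ∃ t : T, ∀ r, ¬ Bad (fun j => σ j (I t (r + j))) := by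
    by_contra hcon
    push Not at hcon
    have h1 : (univ : Finset T) ⊆ univ.biUnion BT := by
      intro t _
      obtain ⟨r, hr⟩ := hcon t
      simp only [mem_biUnion, mem_univ, true_and]
      exact ⟨r, by simp [BT, hr]⟩
    have h2 := card_le_card h1
    have h3 : (univ.biUnion BT).card ≤ 4 * C := by
      refine (card_biUnion_le).trans ?_
      refine (sum_le_sum fun r _ => hBT r).trans ?_
      simp
    rw [card_univ, hcardT] at h2
    omega
  obtain ⟨t, ht⟩ := hex
  let e : Fin 4 ↪ Fin N := ⟨I t, hinj t⟩
  let σ' : Fin 4 → Equiv.Perm (Fin N) := fun j =>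
    ((Equiv.addRight j : Equiv.Perm (Fin 4)).viaFintypeEmbedding e).trans (σ j)
  have hon : ∀ r j, σ' j (I t r) = σ j (I t (r + j)) := by
    intro r j
    have := Equiv.Perm.viaFintypeEmbedding_apply_image (Equiv.addRight j : Equiv.Perm (Fin 4)) e r
    simp only [σ', Equiv.trans_apply]
    exact congrArg (σ j) this
  have hoff : ∀ i, i ∉ Set.range (I t) → ∀ j, σ' j i = σ j i := by
    intro i hi j
    have := Equiv.Perm.viaFintypeEmbedding_apply_notMem_range
      (Equiv.addRight j : Equiv.Perm (Fin 4)) e (b := i) hi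
    simp only [σ', Equiv.trans_apply]
    exact congrArg (σ j) this
  have hlt : (univ.filter fun i => ¬ Bad (fun j => σ j i)).card
      < (univ.filter fun i => ¬ Bad (fun j => σ' j i)).card := by
    apply card_lt_card
    rw [Finset.ssubset_iff_of_subset]
    · refine ⟨i0, ?_, ?_⟩
      · simp only [mem_filter, mem_univ, true_and]
        have h := ht 0
        have h' : (fun j => σ' j i0) = fun j => σ j (I t (0 + j)) := by
          funext j; exact hon 0 j
        rwa [h']
      · simp [hi0]
    · intro i hi
      simp only [mem_filter, mem_univ, true_and] at hi ⊢
      by_cases hr : i ∈ Set.range (I t)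
      · obtain ⟨r, rfl⟩ := hr
        have h' : (fun j => σ' j (I t r)) = fun j => σ j (I t (r + j)) := by
          funext j; exact hon r j
        rw [h']; exact ht r
      · have h' : (fun j => σ' j i) = fun j => σ j i := by
          funext j; exact hoff i hr j
        rwa [h']
  exact absurd (hσ σ') (not_le.2 hlt)

lemma aux_factor {n N : ℕ} (H BG : Finset (Finset (Fin n))) (F : Fin 4 × Fin N → Fin n)
    (hF : Function.Injective F)
    (hB : ∀ t : Fin 4 → Fin N,
      3 ≤ (univ.filter fun r : Fin 4 => (univ.erase r).image (fun j => F (j, t j)) ∈ BG).card)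
    (D : ℕ) (hM : ∀ v, ((BG \ H).filter (fun e => v ∈ e)).card ≤ D)
    (hne : ∀ e ∈ BG, e.Nonempty)
    (hN : 4 * (3 * (D * N) + n * D) < (N - 1).descFactorial 3) :
    HasK4mFactorOn H (univ.image F) := by
  classical
  let tr : Fin 4 → (Fin 4 → Fin N) → Finset (Fin n) :=
    fun r t => (univ.erase r).image (fun j => F (j, t j))
  have htr : ∀ r t t', tr r t = tr r t' → ∀ j, j ≠ r → t j = t' j := by
    intro r t t' h j hj
    have h1 : F (j, t j) ∈ tr r t := mem_image.2 ⟨j, by simp [hj], rfl⟩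
    rw [h] at h1
    obtain ⟨j', _, h2⟩ := mem_image.1 h1
    have h3 := hF h2
    simp only [Prod.mk.injEq] at h3
    obtain ⟨rfl, h4⟩ := h3
    exact h4.symm
  have hMcard : (BG \ H).card ≤ n * D := by
    have h1 : BG \ H ⊆ univ.biUnion fun v => (BG \ H).filter (fun e => v ∈ e) := by
      intro e he
      obtain ⟨v, hv⟩ := hne e (mem_sdiff.1 he).1
      simp only [mem_biUnion, mem_univ, true_and, mem_filter]
      exact ⟨v, he, hv⟩
    refine (card_le_card h1).trans (card_biUnion_le.trans ?_)
    refine (sum_le_sum fun v _ => hM v).trans ?_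
    simp
  let Bad : (Fin 4 → Fin N) → Prop := fun t => ∃ r, tr r t ∈ BG \ H
  have hcount : ∀ (j : Fin 4) (a : Fin N),
      Nat.card {t : Fin 4 → Fin N // t j = a ∧ Bad t} ≤ 3 * (D * N) + n * D := by
    intro j a
    rw [Nat.card_eq_fintype_card, Fintype.card_subtype]
    let W : Fin 4 → Finset (Fin 4 → Fin N) := fun r => univ.filter fun t => t j = a ∧ tr r t ∈ BG \ H
    have h1 : (univ.filter fun t : Fin 4 → Fin N => t j = a ∧ Bad t)
        ⊆ ((univ.erase j).biUnion W) ∪ W j := by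
      intro t ht
      simp only [mem_filter, mem_univ, true_and] at ht
      obtain ⟨hta, r, hr⟩ := ht
      by_cases hrj : r = j
      · subst hrj
        exact mem_union_right _ (by simp only [W, mem_filter, mem_univ, true_and]; exact ⟨hta, hr⟩)
      · refine mem_union_left _ (mem_biUnion.2 ⟨r, by simp [hrj], ?_⟩)
        simp only [W, mem_filter, mem_univ, true_and]; exact ⟨hta, hr⟩
    have hWj : (W j).card ≤ n * D := by
      refine le_trans ?_ hMcard
      refine card_le_card_of_injOn (tr j) ?_ ?_
      · intro t ht
        simp only [W, coe_filter, mem_univ, true_and, Set.mem_setOf_eq] at ht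
        exact ht.2
      · intro t ht t' ht' h
        simp only [W, coe_filter, mem_univ, true_and, Set.mem_setOf_eq] at ht ht'
        funext k
        by_cases hk : k = j
        · rw [hk, ht.1, ht'.1]
        · exact htr j t t' h k hk
    have hWr : ∀ r ∈ univ.erase j, (W r).card ≤ D * N := by
      intro r hr
      have hrj : r ≠ j := (mem_erase.1 hr).1
      have : (W r).card ≤
          (((BG \ H).filter (fun e => F (j, a) ∈ e)) ×ˢ (univ : Finset (Fin N))).card := by
        refine card_le_card_of_injOn (fun t => (tr r t, t r)) ?_ ?_
        · intro t ht
          simp only [W, coe_filter, mem_univ, true_and, Set.mem_setOf_eq] at ht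
          have hm : F (j, a) ∈ tr r t :=
            mem_image.2 ⟨j, by simp [hrj.symm], by rw [ht.1]⟩
          exact mem_product.2 ⟨mem_filter.2 ⟨ht.2, hm⟩, mem_univ _⟩
        · intro t ht t' ht' h
          simp only [Prod.mk.injEq] at h
          funext k
          by_cases hk : k = r
          · rw [hk]; exact h.2
          · exact htr r t t' h.1 k hk
      rw [card_product, card_univ, Fintype.card_fin] at this
      exact this.trans (Nat.mul_le_mul_right _ (hM _))
    refine (card_le_card h1).trans ((card_union_le _ _).trans (Nat.add_le_add ?_ hWj))
    refine card_biUnion_le.trans ((sum_le_sum hWr).trans ?_)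
    rw [sum_const, card_erase_of_mem (mem_univ _)]
    simp
  obtain ⟨σ, hσ⟩ := aux_perm Bad _ hcount hN
  let S : Fin N → Finset (Fin n) := fun i => univ.image fun j : Fin 4 => F (j, σ j i)
  refine ⟨univ.image S, ?_, ?_, ?_⟩
  · intro X hX
    obtain ⟨i, _, rfl⟩ := mem_image.1 hX
    have hinj : Function.Injective fun j : Fin 4 => F (j, σ j i) := by
      intro j j' h
      have := hF h
      simp only [Prod.mk.injEq] at this
      exact this.1
    refine ⟨?_, ?_⟩
    · simp only [S]
      rw [card_image_of_injective _ hinj]; simp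
    · refine (hB (fun j => σ j i)).trans ?_
      refine card_le_card_of_injOn (fun r => tr r (fun j => σ j i)) ?_ ?_
      · intro r hr
        simp only [coe_filter, mem_univ, true_and, Set.mem_setOf_eq] at hr
        refine mem_filter.2 ⟨mem_powersetCard.2 ⟨?_, ?_⟩, ?_⟩
        · exact image_subset_image (erase_subset _ _)
        · simp only [tr]
          rw [card_image_of_injective _ hinj, card_erase_of_mem (mem_univ _)]; simp
        · by_contra hc
          exact hσ i ⟨r, mem_sdiff.2 ⟨hr, hc⟩⟩
      · intro r _ r' _ h
        simp only [tr] at h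
        have h2 := image_injective hinj h
        by_contra hne'
        have : r ∈ univ.erase r' := by simp [hne']
        rw [← h2] at this
        simp at this
  · intro X hX Y hY hXY
    obtain ⟨i, _, rfl⟩ := mem_image.1 hX
    obtain ⟨i', _, rfl⟩ := mem_image.1 hY
    rw [Finset.disjoint_left]
    intro v hv hv'
    obtain ⟨j, _, rfl⟩ := mem_image.1 hv
    obtain ⟨j', _, h⟩ := mem_image.1 hv'
    have h3 := hF h
    simp only [Prod.mk.injEq] at h3
    obtain ⟨rfl, h4⟩ := h3
    exact hXY (congrArg S ((σ j').injective h4).symm)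
  · ext v
    simp only [mem_biUnion, mem_image, mem_univ, true_and, id]
    constructor
    · rintro ⟨X, ⟨i, rfl⟩, hv⟩
      obtain ⟨j, _, rfl⟩ := mem_image.1 hv
      exact ⟨_, rfl⟩
    · rintro ⟨⟨j, x⟩, rfl⟩
      refine ⟨S ((σ j).symm x), ⟨_, rfl⟩, mem_image.2 ⟨j, mem_univ _, by simp⟩⟩

lemma aux_union {n : ℕ} {H : Finset (Finset (Fin n))} {X Y : Finset (Fin n)}
    (hX : HasK4mFactorOn H X) (hY : HasK4mFactorOn H Y) (hd : Disjoint X Y) :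
    HasK4mFactorOn H (X ∪ Y) := by
  classical
  obtain ⟨P, h1, h2, h3⟩ := hX
  obtain ⟨Q, g1, g2, g3⟩ := hY
  have hPQ : ∀ S ∈ P, ∀ T ∈ Q, Disjoint S T := by
    intro S hS T hT
    have a : S ⊆ X := h3 ▸ subset_biUnion_of_mem id hS
    have b : T ⊆ Y := g3 ▸ subset_biUnion_of_mem id hT
    exact Finset.disjoint_of_subset_left a (Finset.disjoint_of_subset_right b hd)
  refine ⟨P ∪ Q, ?_, ?_, ?_⟩
  · intro S hS
    rcases mem_union.1 hS with h | h
    exacts [h1 S h, g1 S h]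
  · intro S hS T hT hne
    rcases mem_union.1 hS with h | h <;> rcases mem_union.1 hT with h' | h'
    · exact h2 S h T h' hne
    · exact hPQ S h T h'
    · exact (hPQ T h' S h).symm
    · exact g2 S h T h' hne
  · rw [union_biUnion, h3, g3]

/-- if every vertex is `α`-good with respect to `𝓑[A,B]` then `H`
has a `K₄⁻`-factor. -/
theorem stmt_19 (α : ℝ) (hα0 : 0 < α) (hα : α < 1 / 100000) :
    ∃ m₀ : ℕ, ∀ m : ℕ, m₀ ≤ m →
      ∀ H : Finset (Finset (Fin (12 * m))), Is3Graph (12 * m) H →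
        ∀ A B : Finset (Fin (12 * m)), Disjoint A B → A ∪ B = Finset.univ →
          A.card = 6 * m → B.card = 6 * m →
          (∀ v : Fin (12 * m),
            (((BGraph A B \ H).filter fun e => v ∈ e).card : ℝ) ≤ α * (12 * m : ℝ) ^ 2) →
          HasK4mFactorOn H Finset.univ := by
  classical
  refine ⟨10, ?_⟩
  intro m hm H _ A B hAB hun hA hB hdeg
  obtain ⟨A', hA'A, hA'⟩ := exists_subset_card_eq (show 4 * m ≤ A.card by omega)
  have hA'' : (A \ A').card = 2 * m := by
    rw [card_sdiff_of_subset hA'A]; omega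
  let D : ℕ := ⌊α * (12 * m : ℝ) ^ 2⌋₊
  have hD : ∀ v, ((BGraph A B \ H).filter (fun e => v ∈ e)).card ≤ D := fun v =>
    Nat.le_floor (hdeg v)
  have hDm : 10000 * D ≤ 15 * m ^ 2 := by
    have h0 : 0 ≤ α * (12 * m : ℝ) ^ 2 := by positivity
    have h1 : (D : ℝ) ≤ α * (12 * m : ℝ) ^ 2 := Nat.floor_le h0
    have h2 : α * (12 * m : ℝ) ^ 2 ≤ 1 / 100000 * (12 * m : ℝ) ^ 2 := by gcongr
    have h3 : (10000 * D : ℝ) ≤ 15 * m ^ 2 := by nlinarith [sq_nonneg (m : ℝ)]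
    exact_mod_cast h3
  have hne : ∀ e ∈ BGraph A B, e.Nonempty := by
    intro e he
    rw [← card_pos, (mem_powersetCard.1 (mem_filter.1 he).1).2]
    norm_num
  have hmem : ∀ e : Finset (Fin (12 * m)), e.card = 3 → (e ∩ A).card % 2 = 1 → e ∈ BGraph A B := by
    intro e h1 h2
    refine mem_filter.2 ⟨mem_powersetCard.2 ⟨?_, h1⟩, h2⟩
    rw [hun]; exact subset_univ _
  have hcard3 : ∀ {N : ℕ} (F : Fin 4 × Fin N → Fin (12 * m)), Function.Injective F →
      ∀ (t : Fin 4 → Fin N) (r : Fin 4), ((univ.erase r).image (fun j => F (j, t j))).card = 3 := by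
    intro N F hF t r
    rw [card_image_of_injective, card_erase_of_mem (mem_univ _)]
    · simp
    · intro j j' h
      have := hF h
      simp only [Prod.mk.injEq] at this
      exact this.1
  -- blocks inside `A'`
  have e1 : Fin 4 × Fin m ≃ A' := Fintype.equivOfCardEq (by simp [hA'])
  let F1 : Fin 4 × Fin m → Fin (12 * m) := fun p => (e1 p).1
  have hF1 : Function.Injective F1 := fun p q h => e1.injective (Subtype.ext h)
  have hF1A : ∀ p, F1 p ∈ A := fun p => hA'A (e1 p).2
  have hI1 : univ.image F1 = A' := by
    ext v
    simp only [mem_image, mem_univ, true_and]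
    constructor
    · rintro ⟨p, rfl⟩; exact (e1 p).2
    · intro hv; exact ⟨e1.symm ⟨v, hv⟩, by simp [F1]⟩
  have k1 : HasK4mFactorOn H (univ.image F1) := by
    refine aux_factor H (BGraph A B) F1 hF1 ?_ D hD hne ?_
    · intro t
      rw [filter_true_of_mem]
      · simp
      · intro r _
        refine hmem _ (hcard3 F1 hF1 t r) ?_
        rw [inter_eq_left.2, hcard3 F1 hF1 t r]
        intro v hv
        obtain ⟨j, _, rfl⟩ := mem_image.1 hv
        exact hF1A _
    · obtain ⟨k, rfl⟩ : ∃ k, m = k + 10 := ⟨m - 10, by omega⟩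
      simp only [Nat.descFactorial_succ, Nat.descFactorial_zero]
      rw [show k + 10 - 1 - 2 = k + 7 by omega, show k + 10 - 1 - 1 = k + 8 by omega,
        show k + 10 - 1 - 0 = k + 9 by omega]
      have := Nat.mul_le_mul_right (k + 10) hDm
      nlinarith
  -- blocks with one vertex in `A \ A'` and three in `B`
  have e2 : Fin (2 * m) ≃ (A \ A' : Finset _) := Fintype.equivOfCardEq (by rw [Fintype.card_coe, hA'']; simp)
  have e3 : Fin 3 × Fin (2 * m) ≃ B := Fintype.equivOfCardEq (by simp [hB]; ring)
  let F2 : Fin 4 × Fin (2 * m) → Fin (12 * m) := fun p =>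
    Fin.cases (motive := fun _ => Fin (12 * m)) (e2 p.2).1 (fun j => (e3 (j, p.2)).1) p.1
  have hF20 : ∀ x, F2 (0, x) = (e2 x).1 := fun x => rfl
  have hF2s : ∀ j x, F2 (Fin.succ j, x) = (e3 (j, x)).1 := fun j x => rfl
  have hm0 : ∀ x, F2 (0, x) ∈ A \ A' := fun x => (e2 x).2
  have hms : ∀ j x, F2 (Fin.succ j, x) ∈ B := fun j x => (e3 (j, x)).2
  have hdis : ∀ v, v ∈ A → v ∈ B → False := fun v h h' => Finset.disjoint_left.1 hAB h h'
  have hF2 : Function.Injective F2 := by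
    rintro ⟨j, x⟩ ⟨j', x'⟩ h
    induction j using Fin.cases with
    | zero =>
      induction j' using Fin.cases with
      | zero =>
        rw [hF20, hF20] at h
        rw [e2.injective (Subtype.ext h)]
      | succ j' =>
        exact (hdis _ (mem_sdiff.1 (hm0 x)).1 (h ▸ hms j' x')).elim
    | succ j =>
      induction j' using Fin.cases with
      | zero =>
        exact (hdis _ (mem_sdiff.1 (hm0 x')).1 (h ▸ hms j x)).elim
      | succ j' =>
        rw [hF2s, hF2s] at h
        have := e3.injective (Subtype.ext h)
        simp only [Prod.mk.injEq] at this
        rw [this.1, this.2]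
  have hI2 : univ.image F2 = (A \ A') ∪ B := by
    ext v
    simp only [mem_image, mem_univ, true_and, mem_union]
    constructor
    · rintro ⟨⟨j, x⟩, rfl⟩
      induction j using Fin.cases with
      | zero => exact Or.inl (hm0 x)
      | succ j => exact Or.inr (hms j x)
    · rintro (hv | hv)
      · exact ⟨(0, e2.symm ⟨v, hv⟩), by rw [hF20]; simp⟩
      · exact ⟨(Fin.succ (e3.symm ⟨v, hv⟩).1, (e3.symm ⟨v, hv⟩).2), by rw [hF2s]; simp⟩
  have k2 : HasK4mFactorOn H (univ.image F2) := by
    refine aux_factor H (BGraph A B) F2 hF2 ?_ D hD hne ?_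
    · intro t
      have : (univ.erase (0 : Fin 4)).card = 3 := by simp
      rw [← this]
      apply card_le_card
      intro r hr
      have hr0 : r ≠ 0 := (mem_erase.1 hr).1
      simp only [mem_filter, mem_univ, true_and]
      refine hmem _ (hcard3 F2 hF2 t r) ?_
      have : (univ.erase r).image (fun j => F2 (j, t j)) ∩ A = {F2 (0, t 0)} := by
        ext v
        simp only [mem_inter, mem_image, mem_erase, mem_univ, and_true, mem_singleton]
        constructor
        · rintro ⟨⟨j, _, rfl⟩, hvA⟩
          induction j using Fin.cases with
          | zero => rfl
          | succ j => exact (hdis _ hvA (hms _ _)).elim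
        · rintro rfl
          exact ⟨⟨0, hr0.symm, rfl⟩, (mem_sdiff.1 (hm0 _)).1⟩
      rw [this, card_singleton]
    · obtain ⟨k, rfl⟩ : ∃ k, m = k + 10 := ⟨m - 10, by omega⟩
      simp only [Nat.descFactorial_succ, Nat.descFactorial_zero]
      rw [show 2 * (k + 10) - 1 - 2 = 2 * k + 17 by omega,
        show 2 * (k + 10) - 1 - 1 = 2 * k + 18 by omega,
        show 2 * (k + 10) - 1 - 0 = 2 * k + 19 by omega]
      have := Nat.mul_le_mul_right (k + 10) hDm
      nlinarith
  rw [hI1] at k1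
  rw [hI2] at k2
  have hfin := aux_union k1 k2 (by
    rw [disjoint_union_right]
    exact ⟨disjoint_sdiff, Finset.disjoint_of_subset_left hA'A hAB⟩)
  rwa [← union_assoc, union_sdiff_of_subset hA'A, hun] at hfin
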